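/- arXiv:2205.04301 — 2 statements merged into one kernel-verified Lean document; each statement's English description precedes it below -/
import Mathlib

section
/- Define A : ℝ₊ → ℝ by A(z) = E_pot(H_{0,1}(·−z) + H_{-1,0}). Then A is of class C² on (0,∞) and there exists a constant C > 0 such that for all z ≥ 1: (1) |A''(z) − 4√2·e^{−√2 z}| ≤ C·z·e^{−2√2 z}; (2) |A'(z) + 4·e^{−√2 z}| ≤ C·z·e^{−2√2 z}; (3) |A(z) − 2·E_pot(H_{0,1}) − 2√2·e^{−√2 z}| ≤ C·z·e^{−2√2 z}. -/
noncomputable section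

open MeasureTheory Real

/-- The φ⁶ kink `H_{0,1}(x) = e^{√2 x} / (1 + e^{2√2 x})^{1/2}`. -/
def H01 (x : ℝ) : ℝ := Real.exp (Real.sqrt 2 * x) / Real.sqrt (1 + Real.exp (2 * Real.sqrt 2 * x))

/-- The reflected kink `H_{-1,0}(x) = -H_{0,1}(-x)`. -/
def Hm10 (x : ℝ) : ℝ := - H01 (-x)

/-- The φ⁶ potential `U(φ) = φ²(1-φ²)²`. -/
def U (p : ℝ) : ℝ := p ^ 2 * (1 - p ^ 2) ^ 2

/-- `U̇(φ) = 2φ - 8φ³ + 6φ⁵`. -/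
def Udot (p : ℝ) : ℝ := 2 * p - 8 * p ^ 3 + 6 * p ^ 5

/-- `Ü(φ) = 2 - 24φ² + 30φ⁴`. -/
def Uddot (p : ℝ) : ℝ := 2 - 24 * p ^ 2 + 30 * p ^ 4

/-- `U⁽³⁾(φ) = -48φ + 120φ³`. -/
def U3 (p : ℝ) : ℝ := -48 * p + 120 * p ^ 3

/-- The `L²` norm of a real function, as `√(∫ f²)`. -/
def L2norm (f : ℝ → ℝ) : ℝ := Real.sqrt (∫ x : ℝ, f x ^ 2)

/-- The `H¹` norm of a real function, as `√(∫ f² + f'²)`. -/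
def H1norm (f : ℝ → ℝ) : ℝ := Real.sqrt (∫ x : ℝ, (f x ^ 2 + deriv f x ^ 2))

/-- Square integrability. -/
def InL2 (f : ℝ → ℝ) : Prop := Integrable (fun x : ℝ => f x ^ 2)

/-- Membership in `H¹(ℝ)`. -/
def InH1 (f : ℝ → ℝ) : Prop := InL2 f ∧ InL2 (deriv f)

/-- The potential energy `E_pot(φ) = ∫ (1/2) φ'² + U(φ)`. -/
def Epot (f : ℝ → ℝ) : ℝ := ∫ x : ℝ, ((1 / 2) * deriv f x ^ 2 + U (f x))

/-- The interaction potential energy `A(z) = E_pot(H_{0,1}(·-z) + H_{-1,0})`. -/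
def Afun (z : ℝ) : ℝ := Epot (fun x => H01 (x - z) + Hm10 x)

open Filter Topology Set

section Kink

lemma H01_pos (x : ℝ) : 0 < H01 x := by
  unfold H01; positivity

lemma one_sub_H01_sq (x : ℝ) : 1 - H01 x ^ 2 = (1 + exp (√2 * x) ^ 2)⁻¹ := by
  have h : exp (2 * √2 * x) = exp (√2 * x) ^ 2 := by rw [← exp_nat_mul]; push_cast; ring_nf
  unfold H01
  rw [h, div_pow, sq_sqrt (by positivity)]
  field_simp
  ring

lemma H01_sq_lt_one (x : ℝ) : H01 x ^ 2 < 1 := by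
  have h := one_sub_H01_sq x
  have : 0 < (1 + exp (√2 * x) ^ 2)⁻¹ := by positivity
  linarith

lemma H01_le_one (x : ℝ) : H01 x ≤ 1 := by
  nlinarith [H01_sq_lt_one x, H01_pos x]

lemma H01_mem_Icc (x : ℝ) : H01 x ∈ Icc (0 : ℝ) 1 := ⟨(H01_pos x).le, H01_le_one x⟩

lemma H01_le_exp (x : ℝ) : H01 x ≤ exp (√2 * x) := by
  unfold H01
  apply div_le_self (exp_pos _).le
  rw [one_le_sqrt]
  linarith [exp_pos (2 * √2 * x)]

lemma exp_sub_H01_le (x : ℝ) : exp (√2 * x) - H01 x ≤ exp (√2 * x) ^ 2 := by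
  have h : exp (2 * √2 * x) = exp (√2 * x) ^ 2 := by rw [← exp_nat_mul]; push_cast; ring_nf
  unfold H01
  rw [h]
  set e := exp (√2 * x)
  have he : 0 < e := exp_pos _
  have h1 : √(1 + e ^ 2) ≤ 1 + e := by
    rw [sqrt_le_left (by positivity)]; nlinarith
  have h2 : e / (1 + e) ≤ e / √(1 + e ^ 2) := by gcongr
  have h3 : e - e ^ 2 ≤ e / (1 + e) := by
    rw [le_div_iff₀ (by positivity)]; nlinarith [pow_pos he 3]
  linarith

lemma hasDerivAt_H01 (x : ℝ) : HasDerivAt H01 (√2 * H01 x * (1 - H01 x ^ 2)) x := by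
  rw [one_sub_H01_sq]
  have h : exp (2 * √2 * x) = exp (√2 * x) ^ 2 := by rw [← exp_nat_mul]; push_cast; ring_nf
  have h1 : HasDerivAt (fun x => exp (√2 * x)) (exp (√2 * x) * √2) x := by
    simpa using ((hasDerivAt_id x).const_mul √2).exp
  have h2 : HasDerivAt (fun x => exp (2 * √2 * x)) (exp (2 * √2 * x) * (2 * √2)) x := by
    simpa using ((hasDerivAt_id x).const_mul (2 * √2)).exp
  have h3 := h1.div ((h2.const_add 1).sqrt (by positivity)) (by positivity)
  refine HasDerivAt.congr_deriv (f := H01) h3 ?_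
  rw [H01, h]
  set e := exp (√2 * x)
  have hq : √(1 + e ^ 2) ^ 2 = 1 + e ^ 2 := sq_sqrt (by positivity)
  have hq0 : 0 < √(1 + e ^ 2) := by positivity
  set q := √(1 + e ^ 2)
  rw [← hq]
  field_simp
  linear_combination e * hq

@[fun_prop]
lemma continuous_H01 : Continuous H01 :=
  continuous_iff_continuousAt.2 fun x => (hasDerivAt_H01 x).continuousAt

end Kink

lemma integrable_exp_neg_abs : Integrable fun x : ℝ => exp (-(√2 * |x|)) := by
  have h2 : 0 < √2 := by positivity
  rw [← integrableOn_univ, ← Iic_union_Ioi (a := (0 : ℝ)), integrableOn_union]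
  constructor
  · refine (integrableOn_exp_mul_Iic h2 0).congr_fun (fun x hx => ?_) measurableSet_Iic
    simp [abs_of_nonpos (show x ≤ 0 from hx)]
  · refine (integrableOn_exp_mul_Ioi (neg_lt_zero.2 h2) 0).congr_fun (fun x hx => ?_)
      measurableSet_Ioi
    simp [abs_of_pos (show 0 < x from hx)]

/-- Decay of a quantity controlled by both exponentials. -/
lemma le_exp_neg_abs {x t : ℝ} (h1 : t ≤ exp (√2 * x)) (h2 : t ≤ exp (-√2 * x)) :
    t ≤ exp (-(√2 * |x|)) := by
  rcases le_total x 0 with hx | hx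
  · simpa [abs_of_nonpos hx] using h1
  · simpa [abs_of_nonneg hx] using h2

lemma integrable_of_le_exp_neg_abs {f : ℝ → ℝ} (hf : Continuous f) (C : ℝ)
    (h : ∀ x, |f x| ≤ C * exp (-(√2 * |x|))) : Integrable f :=
  (integrable_exp_neg_abs.const_mul C).mono' hf.aestronglyMeasurable (ae_of_all _ h)

lemma H01_cube_mul_exp_le (y : ℝ) : H01 y ^ 3 * exp (-√2 * y) ^ 2 ≤ exp (-(√2 * |y|)) := by
  have he : exp (√2 * y) * exp (-√2 * y) = 1 := by rw [← exp_add]; simp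
  have h0 := H01_pos y
  apply le_exp_neg_abs
  · calc H01 y ^ 3 * exp (-√2 * y) ^ 2 ≤ exp (√2 * y) ^ 3 * exp (-√2 * y) ^ 2 := by
          gcongr; exact H01_le_exp y
      _ = exp (√2 * y) * (exp (√2 * y) * exp (-√2 * y)) ^ 2 := by ring
      _ = _ := by rw [he]; ring
  · calc H01 y ^ 3 * exp (-√2 * y) ^ 2 = H01 y ^ 2 * H01 y * exp (-√2 * y) ^ 2 := by ring
      _ ≤ 1 * exp (√2 * y) * exp (-√2 * y) ^ 2 := by
          gcongr
          · exact (H01_sq_lt_one y).le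
          · exact H01_le_exp y
      _ = (exp (√2 * y) * exp (-√2 * y)) * exp (-√2 * y) := by ring
      _ = _ := by rw [he]; ring

lemma H01_cube_mul_exp_le' (y : ℝ) : H01 y ^ 3 * exp (-√2 * y) ≤ exp (-(√2 * |y|)) := by
  have he : exp (√2 * y) * exp (-√2 * y) = 1 := by rw [← exp_add]; simp
  have h0 := H01_pos y
  have h1 := H01_le_one y
  apply le_exp_neg_abs
  · calc H01 y ^ 3 * exp (-√2 * y) = H01 y * H01 y ^ 2 * exp (-√2 * y) := by ring
      _ ≤ 1 * exp (√2 * y) ^ 2 * exp (-√2 * y) := by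
          gcongr; exact H01_le_exp y
      _ = exp (√2 * y) * (exp (√2 * y) * exp (-√2 * y)) := by ring
      _ = _ := by rw [he]; ring
  · exact mul_le_of_le_one_left (exp_pos _).le (pow_le_one₀ h0.le h1)

lemma H01_mul_H01_le {z : ℝ} (hz : 0 < z) (x : ℝ) :
    H01 (x - z) * H01 (-x) ≤ exp (-(√2 * |x|)) := by
  apply le_exp_neg_abs
  · calc H01 (x - z) * H01 (-x) ≤ H01 (x - z) :=
          mul_le_of_le_one_right (H01_pos _).le (H01_le_one _)
      _ ≤ exp (√2 * (x - z)) := H01_le_exp _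
      _ ≤ _ := by gcongr; linarith
  · calc H01 (x - z) * H01 (-x) ≤ H01 (-x) :=
          mul_le_of_le_one_left (H01_pos _).le (H01_le_one _)
      _ ≤ exp (√2 * (-x)) := H01_le_exp _
      _ = _ := by ring_nf

lemma exists_bound_of_continuous {Q : ℝ → ℝ → ℝ} (hQ : Continuous fun p : ℝ × ℝ => Q p.1 p.2) :
    ∃ M > 0, ∀ a ∈ Icc (0 : ℝ) 1, ∀ b ∈ Icc (0 : ℝ) 1, |Q a b| ≤ M := by
  obtain ⟨M, hM⟩ := ((isCompact_Icc (a := (0 : ℝ)) (b := 1)).prod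
    (isCompact_Icc (a := (0 : ℝ)) (b := 1))).exists_bound_of_continuousOn hQ.continuousOn
  exact ⟨max M 1, by positivity, fun a ha b hb => (hM (a, b) ⟨ha, hb⟩).trans (le_max_left _ _)⟩

/-- The interaction integral `∫ a b Q(a, b)` of the two kinks, where `a = H_{0,1}(x - z)` and
`b = -H_{-1,0}(x)`. -/
def interact (Q : ℝ → ℝ → ℝ) (z : ℝ) : ℝ :=
  ∫ x, H01 (x - z) * H01 (-x) * Q (H01 (x - z)) (H01 (-x))

section Interaction

variable {Q Q' : ℝ → ℝ → ℝ}

lemma continuous_interact_integrand (hQ : Continuous fun p : ℝ × ℝ => Q p.1 p.2) (z : ℝ) :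
    Continuous fun x => H01 (x - z) * H01 (-x) * Q (H01 (x - z)) (H01 (-x)) := by
  have : Continuous fun x => Q (H01 (x - z)) (H01 (-x)) :=
    hQ.comp (f := fun x => (H01 (x - z), H01 (-x))) (by fun_prop)
  fun_prop

lemma exists_interact_integrand_bound (hQ : Continuous fun p : ℝ × ℝ => Q p.1 p.2) :
    ∃ M, ∀ z > 0, ∀ x, |H01 (x - z) * H01 (-x) * Q (H01 (x - z)) (H01 (-x))| ≤
      M * exp (-(√2 * |x|)) := by
  obtain ⟨M, hM0, hM⟩ := exists_bound_of_continuous hQ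
  refine ⟨M, fun z hz x => ?_⟩
  have h1 := H01_pos (x - z)
  have h2 := H01_pos (-x)
  rw [abs_mul, abs_of_pos (mul_pos h1 h2), mul_comm]
  exact mul_le_mul (hM _ (H01_mem_Icc _) _ (H01_mem_Icc _)) (H01_mul_H01_le hz x)
    (mul_pos h1 h2).le hM0.le

lemma integrable_interact (hQ : Continuous fun p : ℝ × ℝ => Q p.1 p.2) {z : ℝ} (hz : 0 < z) :
    Integrable fun x => H01 (x - z) * H01 (-x) * Q (H01 (x - z)) (H01 (-x)) := by
  obtain ⟨M, hM⟩ := exists_interact_integrand_bound hQ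
  exact integrable_of_le_exp_neg_abs (continuous_interact_integrand hQ z) M (hM z hz)

lemma continuousOn_interact (hQ : Continuous fun p : ℝ × ℝ => Q p.1 p.2) :
    ContinuousOn (interact Q) (Ioi 0) := by
  obtain ⟨M, hM⟩ := exists_interact_integrand_bound hQ
  refine continuousOn_of_dominated (bound := fun x => M * exp (-(√2 * |x|)))
    (fun z _ => (continuous_interact_integrand hQ z).aestronglyMeasurable)
    (fun z hz => ae_of_all _ (hM z hz)) (integrable_exp_neg_abs.const_mul M)
    (ae_of_all _ fun x => Continuous.continuousOn ?_)
  have : Continuous fun z => Q (H01 (x - z)) (H01 (-x)) :=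
    hQ.comp (f := fun z => (H01 (x - z), H01 (-x))) (by fun_prop)
  fun_prop

lemma hasDerivAt_interact (hQ : Continuous fun p : ℝ × ℝ => Q p.1 p.2)
    (hQ' : Continuous fun p : ℝ × ℝ => Q' p.1 p.2)
    (hd : ∀ a b, HasDerivAt (fun a => Q a b) (Q' a b) a) {z : ℝ} (hz : 0 < z) :
    HasDerivAt (interact Q)
      (interact (fun a b => -√2 * (1 - a ^ 2) * (Q a b + a * Q' a b)) z) z := by
  have hc : Continuous fun p : ℝ × ℝ =>
      (fun a b => -√2 * (1 - a ^ 2) * (Q a b + a * Q' a b)) p.1 p.2 := by fun_prop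
  obtain ⟨M, hM⟩ := exists_interact_integrand_bound
    (Q := fun a b => -√2 * (1 - a ^ 2) * (Q a b + a * Q' a b)) hc
  refine (hasDerivAt_integral_of_dominated_loc_of_deriv_le (Ioi_mem_nhds hz)
    (Eventually.of_forall fun w => (continuous_interact_integrand hQ w).aestronglyMeasurable)
    (integrable_interact hQ hz) (continuous_interact_integrand
      (Q := fun a b => -√2 * (1 - a ^ 2) * (Q a b + a * Q' a b)) hc z).aestronglyMeasurable
    (ae_of_all _ fun x w hw => hM w hw x) (integrable_exp_neg_abs.const_mul M)
    (ae_of_all _ fun x w _ => ?_)).2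
  have h1 : HasDerivAt (fun w => H01 (x - w))
      (√2 * H01 (x - w) * (1 - H01 (x - w) ^ 2) * (-1)) w :=
    (hasDerivAt_H01 (x - w)).comp w ((hasDerivAt_id w).const_sub x)
  have h2 := (hd (H01 (x - w)) (H01 (-x))).comp w h1
  refine ((h1.mul_const (H01 (-x))).mul h2).congr_deriv ?_
  simp only [Function.comp]
  ring

end Interaction

/-- The coefficient of `exp (-√2 z)` in the interaction integral with `Q(a, b) = a² g(a)`. -/
def leadCoeff (g : ℝ → ℝ) : ℝ := ∫ y, H01 y ^ 3 * g (H01 y) * exp (-√2 * y)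

section LeadCoeff

variable {g g' : ℝ → ℝ}

lemma exists_bound_on_Icc (hg : Continuous g) : ∃ M > 0, ∀ a ∈ Icc (0 : ℝ) 1, |g a| ≤ M := by
  obtain ⟨M, hM0, hM⟩ := exists_bound_of_continuous (Q := fun a _ => g a) (by fun_prop)
  exact ⟨M, hM0, fun a ha => hM a ha 0 (by simp)⟩

lemma exists_leadCoeff_integrand_bound (hg : Continuous g) :
    ∃ M, ∀ y, |H01 y ^ 3 * g (H01 y) * exp (-√2 * y)| ≤ M * exp (-(√2 * |y|)) := by
  obtain ⟨M, hM0, hM⟩ := exists_bound_on_Icc hg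
  refine ⟨M, fun y => ?_⟩
  have h := H01_pos y
  calc |H01 y ^ 3 * g (H01 y) * exp (-√2 * y)|
      = |g (H01 y)| * (H01 y ^ 3 * exp (-√2 * y)) := by
        rw [abs_mul, abs_mul, abs_of_pos (pow_pos h 3), abs_of_pos (exp_pos _)]; ring
    _ ≤ _ := by
        gcongr
        · exact hM _ (H01_mem_Icc y)
        · exact H01_cube_mul_exp_le' y

lemma integrable_leadCoeff (hg : Continuous g) :
    Integrable fun y => H01 y ^ 3 * g (H01 y) * exp (-√2 * y) := by
  obtain ⟨M, hM⟩ := exists_leadCoeff_integrand_bound hg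
  exact integrable_of_le_exp_neg_abs (by fun_prop) M hM

lemma leadCoeff_const_mul (c : ℝ) (g : ℝ → ℝ) : leadCoeff (fun a => c * g a) = c * leadCoeff g := by
  unfold leadCoeff
  rw [← integral_const_mul]
  congr 1 with y
  ring

lemma tendsto_exp_sqrt_two_atBot : Tendsto (fun x => exp (√2 * x)) atBot (𝓝 0) :=
  tendsto_exp_atBot.comp (tendsto_id.const_mul_atBot (by positivity))

lemma tendsto_exp_neg_abs_atTop : Tendsto (fun x => exp (-(√2 * |x|))) atTop (𝓝 0) :=
  tendsto_exp_neg_atTop_nhds_zero.comp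
    (tendsto_abs_atTop_atTop.const_mul_atTop (by positivity))

lemma tendsto_exp_neg_abs_atBot : Tendsto (fun x => exp (-(√2 * |x|))) atBot (𝓝 0) :=
  tendsto_exp_neg_atTop_nhds_zero.comp
    (tendsto_abs_atBot_atTop.const_mul_atTop (by positivity))

lemma leadCoeff_deriv (hg : Continuous g) (hg' : Continuous g')
    (hd : ∀ a, HasDerivAt g (g' a) a) :
    leadCoeff (fun a => -√2 * (1 - a ^ 2) * (3 * g a + a * g' a)) = -√2 * leadCoeff g := by
  obtain ⟨M, hM⟩ := exists_leadCoeff_integrand_bound hg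
  have hi1 := integrable_leadCoeff (g := fun a => -√2 * (1 - a ^ 2) * (3 * g a + a * g' a))
    (by fun_prop)
  have hi2 := (integrable_leadCoeff hg).const_mul √2
  have hbot : Tendsto (fun y => H01 y ^ 3 * g (H01 y) * exp (-√2 * y)) atBot (𝓝 0) :=
    squeeze_zero_norm hM (by simpa using tendsto_exp_neg_abs_atBot.const_mul M)
  have htop : Tendsto (fun y => H01 y ^ 3 * g (H01 y) * exp (-√2 * y)) atTop (𝓝 0) :=
    squeeze_zero_norm hM (by simpa using tendsto_exp_neg_abs_atTop.const_mul M)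
  have key := integral_of_hasDerivAt_of_tendsto (fun y => ?_) (hi1.add hi2).neg hbot htop
  · simp only [Pi.add_apply, Pi.neg_apply] at key
    rw [integral_neg, integral_add hi1 hi2, integral_const_mul] at key
    unfold leadCoeff
    linarith
  · have h1 := hasDerivAt_H01 y
    have h2 := (hd (H01 y)).comp y h1
    have h3 : HasDerivAt (fun x => exp (-√2 * x)) (exp (-√2 * y) * -√2) y := by
      simpa using ((hasDerivAt_id y).const_mul (-√2)).exp
    refine (((h1.pow 3).mul h2).mul h3).congr_deriv ?_
    simp only [Function.comp, Pi.add_apply, Pi.neg_apply, Pi.mul_apply, Pi.pow_apply]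
    push_cast
    ring

lemma leadCoeff_kink : leadCoeff (fun a => 6 - 6 * a ^ 2) = √2 := by
  have hi := integrable_leadCoeff (g := fun a => 6 - 6 * a ^ 2) (by fun_prop)
  have h2 : √2 ^ 2 = 2 := sq_sqrt (by norm_num)
  have hbot : Tendsto (fun y => -√2 * (H01 y * exp (-√2 * y)) ^ 3) atBot (𝓝 (-√2)) := by
    have h : Tendsto (fun y => H01 y * exp (-√2 * y)) atBot (𝓝 1) := by
      have ht : Tendsto (fun y => 1 - exp (√2 * y)) atBot (𝓝 1) := by
        simpa using tendsto_exp_sqrt_two_atBot.const_sub 1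
      refine tendsto_of_tendsto_of_tendsto_of_le_of_le ht tendsto_const_nhds (fun y => ?_)
        (fun y => ?_)
      all_goals
        have he : exp (√2 * y) * exp (-√2 * y) = 1 := by rw [← exp_add]; simp
        have hp := exp_pos (-√2 * y)
      · have := mul_le_mul_of_nonneg_right (exp_sub_H01_le y) hp.le
        simp only
        linear_combination this - (1 - exp (√2 * y)) * he
      · have := mul_le_mul_of_nonneg_right (H01_le_exp y) hp.le
        simp only
        linarith
    simpa using (h.pow 3).const_mul (-√2)
  have htop : Tendsto (fun y => -√2 * (H01 y * exp (-√2 * y)) ^ 3) atTop (𝓝 0) := by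
    have h : Tendsto (fun y => H01 y * exp (-√2 * y)) atTop (𝓝 0) := by
      have ht : Tendsto (fun y => exp (-√2 * y)) atTop (𝓝 0) := by
        have := tendsto_exp_neg_atTop_nhds_zero.comp
          ((tendsto_id (α := ℝ)).const_mul_atTop (show 0 < √2 by positivity))
        refine this.congr fun y => ?_
        simp
      refine tendsto_of_tendsto_of_tendsto_of_le_of_le tendsto_const_nhds ht (fun y => ?_)
        (fun y => ?_)
      · exact (mul_pos (H01_pos y) (exp_pos _)).le
      · exact mul_le_of_le_one_left (exp_pos _).le (H01_le_one y)
    simpa using (h.pow 3).const_mul (-√2)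
  have key := integral_of_hasDerivAt_of_tendsto (fun y => ?_) hi hbot htop
  · unfold leadCoeff
    linarith
  · have h1 := hasDerivAt_H01 y
    have h3 : HasDerivAt (fun x => exp (-√2 * x)) (exp (-√2 * y) * -√2) y := by
      simpa using ((hasDerivAt_id y).const_mul (-√2)).exp
    refine (((h1.mul h3).pow 3).const_mul (-√2)).congr_deriv ?_
    have he : exp (√2 * y) * exp (-√2 * y) = 1 := by rw [← exp_add]; simp
    have hs : H01 y ^ 2 * exp (-√2 * y) ^ 2 = 1 - H01 y ^ 2 := by
      have h4 := one_sub_H01_sq y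
      have h5 : H01 y ^ 2 = exp (√2 * y) ^ 2 * (1 + exp (√2 * y) ^ 2)⁻¹ := by
        have : (1 + exp (√2 * y) ^ 2) * (1 + exp (√2 * y) ^ 2)⁻¹ = 1 :=
          mul_inv_cancel₀ (by positivity)
        linarith
      rw [h4, h5]
      linear_combination (1 + exp (√2 * y) ^ 2)⁻¹ * (exp (√2 * y) * exp (-√2 * y) + 1) * he
    push_cast
    simp only [Pi.mul_apply]
    linear_combination (6 * H01 y ^ 3 * exp (-√2 * y)) * hs
      + 3 * H01 y ^ 5 * exp (-√2 * y) ^ 3 * h2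

end LeadCoeff

lemma exp_sq_eq (z : ℝ) : exp (-√2 * z) ^ 2 = exp (-(2 * √2) * z) := by
  rw [← exp_nat_mul]; push_cast; ring_nf

lemma interact_left_asymptotic {g : ℝ → ℝ} (hg : Continuous g) :
    ∃ C > 0, ∀ z, |interact (fun a _ => a ^ 2 * g a) z - exp (-√2 * z) * leadCoeff g| ≤
      C * exp (-(2 * √2) * z) := by
  obtain ⟨M, hM0, hM⟩ := exists_bound_on_Icc hg
  have hI : 0 ≤ ∫ x : ℝ, exp (-(√2 * |x|)) := integral_nonneg fun x => (exp_pos _).le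
  refine ⟨M * (∫ x : ℝ, exp (-(√2 * |x|))) + 1, by positivity, fun z => ?_⟩
  have h1 : interact (fun a _ => a ^ 2 * g a) z =
      ∫ y, H01 y ^ 3 * g (H01 y) * H01 (-(y + z)) := by
    unfold interact
    rw [← integral_sub_right_eq_self (fun y => H01 y ^ 3 * g (H01 y) * H01 (-(y + z))) z]
    congr 1 with x
    rw [sub_add_cancel]
    ring
  have hexp : ∀ y, exp (√2 * -(y + z)) = exp (-√2 * z) * exp (-√2 * y) := fun y => by
    rw [← exp_add]; ring_nf
  have hi1 : Integrable fun y => H01 y ^ 3 * g (H01 y) * H01 (-(y + z)) := by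
    refine integrable_of_le_exp_neg_abs (by fun_prop) (M * exp (-√2 * z)) fun y => ?_
    have h := H01_pos y
    have h' := H01_pos (-(y + z))
    calc |H01 y ^ 3 * g (H01 y) * H01 (-(y + z))|
        = |g (H01 y)| * (H01 y ^ 3 * H01 (-(y + z))) := by
          rw [abs_mul, abs_mul, abs_of_pos (pow_pos h 3), abs_of_pos h']; ring
      _ ≤ M * (H01 y ^ 3 * (exp (-√2 * z) * exp (-√2 * y))) := by
          gcongr
          · exact hM _ (H01_mem_Icc y)
          · exact hexp y ▸ H01_le_exp _
      _ = M * exp (-√2 * z) * (H01 y ^ 3 * exp (-√2 * y)) := by ring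
      _ ≤ _ := by gcongr; exact H01_cube_mul_exp_le' y
  have hi2 := (integrable_leadCoeff hg).const_mul (exp (-√2 * z))
  rw [h1, leadCoeff, ← integral_const_mul, ← integral_sub hi1 hi2]
  have hb : ∀ y, ‖H01 y ^ 3 * g (H01 y) * H01 (-(y + z)) -
      exp (-√2 * z) * (H01 y ^ 3 * g (H01 y) * exp (-√2 * y))‖ ≤
      M * exp (-√2 * z) ^ 2 * exp (-(√2 * |y|)) := fun y => by
    have h := H01_pos y
    have h3 : |H01 (-(y + z)) - exp (-√2 * z) * exp (-√2 * y)| ≤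
        (exp (-√2 * z) * exp (-√2 * y)) ^ 2 := by
      rw [← hexp, abs_sub_comm, abs_of_nonneg (sub_nonneg.2 (H01_le_exp _))]
      exact exp_sub_H01_le _
    calc _ = |g (H01 y)| * (H01 y ^ 3 * |H01 (-(y + z)) - exp (-√2 * z) * exp (-√2 * y)|) := by
          rw [norm_eq_abs, ← abs_of_pos (pow_pos h 3), ← abs_mul, ← abs_mul,
            abs_of_pos (pow_pos h 3)]
          ring_nf
      _ ≤ M * (H01 y ^ 3 * (exp (-√2 * z) * exp (-√2 * y)) ^ 2) := by
          gcongr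
          exact hM _ (H01_mem_Icc y)
      _ = M * exp (-√2 * z) ^ 2 * (H01 y ^ 3 * exp (-√2 * y) ^ 2) := by ring
      _ ≤ _ := by gcongr; exact H01_cube_mul_exp_le y
  have := norm_integral_le_of_norm_le (integrable_exp_neg_abs.const_mul _) (ae_of_all _ hb)
  rw [integral_const_mul, norm_eq_abs] at this
  rw [← exp_sq_eq]
  nlinarith [exp_pos (-√2 * z), sq_nonneg (exp (-√2 * z))]

lemma interact_swap (Q : ℝ → ℝ → ℝ) (z : ℝ) :
    interact (fun a b => Q b a) z = interact Q z := by
  unfold interact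
  rw [← integral_sub_left_eq_self
    (fun x => H01 (x - z) * H01 (-x) * Q (H01 (x - z)) (H01 (-x))) volume z]
  congr 1 with x
  rw [show z - x - z = -x by ring, show -(z - x) = x - z by ring]
  ring

lemma H01_mul_H01_sq_le (z x : ℝ) :
    (H01 (x - z) * H01 (-x)) ^ 2 ≤ exp (-√2 * z) ^ 2 *
      ((Icc 0 z).indicator 1 x + exp (-(√2 * |x|)) + exp (-(√2 * |x - z|))) := by
  have ha := H01_pos (x - z)
  have hb := H01_pos (-x)
  have ha' := H01_le_exp (x - z)
  have hb' := H01_le_exp (-x)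
  have h1 := H01_le_one (x - z)
  have h2 := H01_le_one (-x)
  have hind : (0 : ℝ) ≤ (Icc 0 z).indicator 1 x := indicator_nonneg (fun _ _ => zero_le_one) x
  have hp : 0 < √2 := by positivity
  rcases lt_or_ge x 0 with hx | hx
  · calc (H01 (x - z) * H01 (-x)) ^ 2 ≤ (exp (√2 * (x - z)) * 1) ^ 2 := by gcongr
      _ = exp (-√2 * z) ^ 2 * exp (√2 * x) ^ 2 := by rw [← mul_pow, ← exp_add]; ring_nf
      _ ≤ exp (-√2 * z) ^ 2 * exp (-(√2 * |x|)) := by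
          gcongr
          rw [abs_of_neg hx, ← exp_nat_mul]
          gcongr
          push_cast
          nlinarith
      _ ≤ _ := by gcongr; linarith [exp_pos (-(√2 * |x - z|))]
  rcases le_or_gt x z with hxz | hxz
  · calc (H01 (x - z) * H01 (-x)) ^ 2 ≤ (exp (√2 * (x - z)) * exp (√2 * -x)) ^ 2 := by gcongr
      _ = exp (-√2 * z) ^ 2 * (Icc 0 z).indicator 1 x := by
          rw [indicator_of_mem (show x ∈ Icc 0 z from ⟨hx, hxz⟩), ← exp_add, Pi.one_apply, mul_one]
          ring_nf
      _ ≤ _ := by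
          gcongr
          linarith [exp_pos (-(√2 * |x - z|)), exp_pos (-(√2 * |x|))]
  · calc (H01 (x - z) * H01 (-x)) ^ 2 ≤ (1 * exp (√2 * -x)) ^ 2 := by gcongr
      _ = exp (-√2 * z) ^ 2 * exp (-(√2 * (x - z))) ^ 2 := by
          rw [← mul_pow, ← exp_add]; ring_nf
      _ ≤ exp (-√2 * z) ^ 2 * exp (-(√2 * |x - z|)) := by
          gcongr
          rw [abs_of_pos (sub_pos.2 hxz), ← exp_nat_mul]
          gcongr
          push_cast
          nlinarith
      _ ≤ _ := by gcongr; linarith [exp_pos (-(√2 * |x|))]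

lemma interact_remainder_bound {r : ℝ → ℝ → ℝ} (hr : Continuous fun p : ℝ × ℝ => r p.1 p.2) :
    ∃ C > 0, ∀ z ≥ 1, |interact (fun a b => a * b * r a b) z| ≤ C * z * exp (-(2 * √2) * z) := by
  obtain ⟨M, hM0, hM⟩ := exists_bound_of_continuous hr
  set I := ∫ x : ℝ, exp (-(√2 * |x|)) with hIdef
  have hI : 0 ≤ I := integral_nonneg fun x => (exp_pos _).le
  refine ⟨M * (1 + 2 * I), by positivity, fun z hz => ?_⟩
  have hz0 : 0 < z := by linarith
  have hb : ∀ x, ‖H01 (x - z) * H01 (-x) * (H01 (x - z) * H01 (-x) * r (H01 (x - z)) (H01 (-x)))‖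
      ≤ M * exp (-√2 * z) ^ 2 * ((Icc 0 z).indicator 1 x + exp (-(√2 * |x|)) +
        exp (-(√2 * |x - z|))) := fun x => by
    calc _ = |r (H01 (x - z)) (H01 (-x))| * (H01 (x - z) * H01 (-x)) ^ 2 := by
          rw [norm_eq_abs, ← mul_assoc, abs_mul, abs_mul_self, mul_comm, sq]
      _ ≤ M * _ := mul_le_mul (hM _ (H01_mem_Icc _) _ (H01_mem_Icc _))
          (H01_mul_H01_sq_le z x) (sq_nonneg _) hM0.le
      _ = _ := by ring
  have hi1 : Integrable ((Icc 0 z).indicator (1 : ℝ → ℝ)) :=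
    (integrable_indicator_iff measurableSet_Icc).2 (by
      simp [Pi.one_def])
  have hi2 := integrable_exp_neg_abs
  have hi3 := hi2.comp_sub_right z
  have hi12 : Integrable fun x => (Icc 0 z).indicator (1 : ℝ → ℝ) x + exp (-(√2 * |x|)) :=
    hi1.add hi2
  have hval : ∫ x, ((Icc 0 z).indicator (1 : ℝ → ℝ) x + exp (-(√2 * |x|)) +
      exp (-(√2 * |x - z|))) = z + I + I := by
    rw [integral_add hi12 hi3, integral_add hi1 hi2,
      integral_sub_right_eq_self (fun x => exp (-(√2 * |x|))) z, ← hIdef,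
      integral_indicator_one measurableSet_Icc]
    simp [hz0.le]
  have := norm_integral_le_of_norm_le ((hi12.add hi3).const_mul _) (ae_of_all _ hb)
  simp only [Pi.add_apply] at this
  rw [integral_const_mul, norm_eq_abs, hval, exp_sq_eq] at this
  refine this.trans ?_
  have h1 : z + I + I ≤ (1 + 2 * I) * z := by nlinarith
  calc M * exp (-(2 * √2) * z) * (z + I + I) ≤ M * exp (-(2 * √2) * z) * ((1 + 2 * I) * z) := by
        gcongr
    _ = _ := by ring

/-- Interaction densities split into two one-kink terms and a remainder quadratic in both kinks. -/
def kinkSplit (g h : ℝ → ℝ) (r : ℝ → ℝ → ℝ) (a b : ℝ) : ℝ :=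
  a ^ 2 * g a + b ^ 2 * h b + a * b * r a b

section KinkSplit

variable {g g' h : ℝ → ℝ} {r r' : ℝ → ℝ → ℝ}

lemma continuous_kinkSplit (hg : Continuous g) (hh : Continuous h)
    (hr : Continuous fun p : ℝ × ℝ => r p.1 p.2) :
    Continuous fun p : ℝ × ℝ => kinkSplit g h r p.1 p.2 := by
  unfold kinkSplit; fun_prop

lemma interact_kinkSplit_asymptotic (hg : Continuous g) (hh : Continuous h)
    (hr : Continuous fun p : ℝ × ℝ => r p.1 p.2) :
    ∃ C > 0, ∀ z ≥ 1, |interact (kinkSplit g h r) z -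
      (leadCoeff g + leadCoeff h) * exp (-√2 * z)| ≤ C * z * exp (-(2 * √2) * z) := by
  obtain ⟨C₁, hC₁, h₁⟩ := interact_left_asymptotic hg
  obtain ⟨C₂, hC₂, h₂⟩ := interact_left_asymptotic hh
  obtain ⟨C₃, hC₃, h₃⟩ := interact_remainder_bound hr
  refine ⟨C₁ + C₂ + C₃, by positivity, fun z hz => ?_⟩
  have hz0 : 0 < z := by linarith
  have hsplit : interact (kinkSplit g h r) z = interact (fun a _ => a ^ 2 * g a) z +
      interact (fun a _ => a ^ 2 * h a) z + interact (fun a b => a * b * r a b) z := by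
    rw [← interact_swap (fun a _ => a ^ 2 * h a)]
    have i1 := integrable_interact (Q := fun a _ => a ^ 2 * g a) (by fun_prop) hz0
    have i2 := integrable_interact (Q := fun _ b => b ^ 2 * h b) (by fun_prop) hz0
    have i3 := integrable_interact (Q := fun a b => a * b * r a b) (by fun_prop) hz0
    unfold interact
    rw [← integral_add i1 i2, ← integral_add (by exact i1.add i2) i3]
    congr 1 with x
    unfold kinkSplit
    ring
  specialize h₁ z
  specialize h₂ z
  specialize h₃ z hz
  rw [hsplit]
  have hE := exp_pos (-(2 * √2) * z)
  have hzE : exp (-(2 * √2) * z) ≤ z * exp (-(2 * √2) * z) := by nlinarith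
  have h4 := mul_le_mul_of_nonneg_left hzE hC₁.le
  have h5 := mul_le_mul_of_nonneg_left hzE hC₂.le
  rw [abs_le] at *
  constructor <;> nlinarith

lemma hasDerivAt_interact_kinkSplit (hg : Continuous g) (hg' : Continuous g') (hh : Continuous h)
    (hr : Continuous fun p : ℝ × ℝ => r p.1 p.2) (hr' : Continuous fun p : ℝ × ℝ => r' p.1 p.2)
    (hdg : ∀ a, HasDerivAt g (g' a) a) (hdr : ∀ a b, HasDerivAt (fun a => r a b) (r' a b) a)
    {z : ℝ} (hz : 0 < z) :
    HasDerivAt (interact (kinkSplit g h r)) (interact (kinkSplit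
      (fun a => -√2 * (1 - a ^ 2) * (3 * g a + a * g' a)) (fun b => -√2 * h b)
      (fun a b => √2 * a * b * h b - √2 * (1 - a ^ 2) * (2 * r a b + a * r' a b))) z) z := by
  have key := hasDerivAt_interact (Q := kinkSplit g h r)
    (Q' := fun a b => 2 * a * g a + a ^ 2 * g' a + (b * r a b + a * b * r' a b))
    (continuous_kinkSplit hg hh hr) (by fun_prop) (fun a b => ?_) hz
  · convert key using 2
    ext a b
    unfold kinkSplit
    ring
  · unfold kinkSplit
    have h1 := (((hasDerivAt_id a).pow 2).mul (hdg a)).add_const (b ^ 2 * h b)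
    have h2 := ((hasDerivAt_id a).mul_const b).mul (hdr a b)
    refine (h1.add h2).congr_deriv ?_
    simp

end KinkSplit

section Energy

lemma deriv_H01 (x : ℝ) : deriv H01 x = √2 * H01 x * (1 - H01 x ^ 2) := (hasDerivAt_H01 x).deriv

lemma Epot_H01 : Epot H01 = ∫ x, 2 * U (H01 x) := by
  have h2 : √2 ^ 2 = 2 := sq_sqrt (by norm_num)
  unfold Epot
  congr 1 with x
  rw [deriv_H01, U]
  linear_combination (1 / 2) * H01 x ^ 2 * (1 - H01 x ^ 2) ^ 2 * h2

lemma integrable_U_H01 : Integrable fun x => 2 * U (H01 x) := by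
  refine integrable_of_le_exp_neg_abs (by unfold U; fun_prop) 2 fun x => ?_
  have h0 := H01_pos x
  have h1 := H01_le_one x
  have h2 := one_sub_H01_sq x
  have h3 := H01_sq_lt_one x
  have hU : 0 ≤ U (H01 x) := by unfold U; positivity
  rw [abs_of_nonneg (by positivity)]
  gcongr
  have hs : 0 ≤ 1 - H01 x ^ 2 := by linarith
  have hs1 : 1 - H01 x ^ 2 ≤ 1 := by nlinarith
  apply le_exp_neg_abs
  · calc U (H01 x) = H01 x * (H01 x * (1 - H01 x ^ 2) ^ 2) := by unfold U; ring
      _ ≤ H01 x * 1 := by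
          gcongr
          exact mul_le_one₀ h1 (by positivity) (pow_le_one₀ hs hs1)
      _ ≤ _ := by simpa using H01_le_exp x
  · have he : exp (√2 * x) * exp (-√2 * x) = 1 := by rw [← exp_add]; simp
    calc U (H01 x) = H01 x * (H01 x * (1 - H01 x ^ 2)) * (1 - H01 x ^ 2) := by unfold U; ring
      _ ≤ 1 * (1 * 1) * (1 - H01 x ^ 2) := by gcongr
      _ = (1 + exp (√2 * x) ^ 2)⁻¹ := by rw [h2]; ring
      _ ≤ _ := by
          rw [inv_le_iff_one_le_mul₀ (by positivity)]
          nlinarith [exp_pos (-√2 * x), sq_nonneg (exp (√2 * x) - 1), exp_pos (√2 * x)]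

lemma Afun_eq {z : ℝ} (hz : 0 < z) :
    Afun z = 2 * Epot H01 + interact (kinkSplit (fun a => 6 - 6 * a ^ 2) (fun b => 6 - 6 * b ^ 2)
      (fun a b => -12 + 15 * a ^ 2 + 15 * b ^ 2 - 18 * a * b)) z := by
  have h2 : √2 ^ 2 = 2 := sq_sqrt (by norm_num)
  have i1 : Integrable fun x => 2 * U (H01 (x - z)) := integrable_U_H01.comp_sub_right z
  have i2 : Integrable fun x => 2 * U (H01 (-x)) := integrable_U_H01.comp_neg
  have i3 := integrable_interact (Q := kinkSplit (fun a => 6 - 6 * a ^ 2) (fun b => 6 - 6 * b ^ 2)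
      (fun a b => -12 + 15 * a ^ 2 + 15 * b ^ 2 - 18 * a * b))
      (continuous_kinkSplit (by fun_prop) (by fun_prop) (by fun_prop)) hz
  have e1 : ∫ x, 2 * U (H01 (x - z)) = Epot H01 :=
    (integral_sub_right_eq_self (fun x => 2 * U (H01 x)) z).trans Epot_H01.symm
  have e2 : ∫ x, 2 * U (H01 (-x)) = Epot H01 :=
    (integral_neg_eq_self (fun x => 2 * U (H01 x)) volume).trans Epot_H01.symm
  rw [two_mul (Epot H01)]
  nth_rw 1 [← e1]
  rw [← e2, interact, ← integral_add i1 i2, ← integral_add (by exact i1.add i2) i3, Afun, Epot]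
  congr 1 with x
  have d1 : HasDerivAt (fun x => H01 (x - z)) (√2 * H01 (x - z) * (1 - H01 (x - z) ^ 2)) x :=
    (hasDerivAt_H01 (x - z)).comp_sub_const x z
  have d2 : HasDerivAt Hm10 (-(√2 * H01 (-x) * (1 - H01 (-x) ^ 2) * -1)) x :=
    ((hasDerivAt_H01 (-x)).comp x (hasDerivAt_neg x)).neg
  have d : HasDerivAt (fun x => H01 (x - z) + Hm10 x) _ x := d1.add d2
  rw [d.deriv]
  simp only [kinkSplit, U, Hm10]
  set a := H01 (x - z)
  set b := H01 (-x)
  linear_combination (1 / 2) * (a * (1 - a ^ 2) + b * (1 - b ^ 2)) ^ 2 * h2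

end Energy

/-- Asymptotics of `A` and its first two derivatives. -/
theorem A_asymptotics :
    ContDiffOn ℝ 2 Afun (Set.Ioi 0) ∧
    ∃ C > (0:ℝ), ∀ z : ℝ, 1 ≤ z →
      |deriv (deriv Afun) z - 4 * Real.sqrt 2 * Real.exp (-(Real.sqrt 2) * z)| ≤
          C * z * Real.exp (-(2 * Real.sqrt 2) * z) ∧
      |deriv Afun z + 4 * Real.exp (-(Real.sqrt 2) * z)| ≤
          C * z * Real.exp (-(2 * Real.sqrt 2) * z) ∧
      |Afun z - 2 * Epot H01 - 2 * Real.sqrt 2 * Real.exp (-(Real.sqrt 2) * z)| ≤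
          C * z * Real.exp (-(2 * Real.sqrt 2) * z) := by
  set g₀ : ℝ → ℝ := fun a => 6 - 6 * a ^ 2 with hg₀
  set g₀' : ℝ → ℝ := fun a => -12 * a with hg₀'
  set r₀ : ℝ → ℝ → ℝ := fun a b => -12 + 15 * a ^ 2 + 15 * b ^ 2 - 18 * a * b with hr₀
  set r₀' : ℝ → ℝ → ℝ := fun a b => 30 * a - 18 * b with hr₀'
  set g₁ : ℝ → ℝ := fun a => -√2 * (1 - a ^ 2) * (3 * g₀ a + a * g₀' a) with hg₁
  set r₁ : ℝ → ℝ → ℝ := fun a b =>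
    √2 * a * b * g₀ b - √2 * (1 - a ^ 2) * (2 * r₀ a b + a * r₀' a b) with hr₁
  set g₁' : ℝ → ℝ := fun a => -√2 * (-96 * a + 120 * a ^ 3) with hg₁'
  set r₁' : ℝ → ℝ → ℝ := fun a b => √2 * b * g₀ b +
    √2 * (2 * a * (-24 + 60 * a ^ 2 + 30 * b ^ 2 - 54 * a * b) -
      (1 - a ^ 2) * (120 * a - 54 * b)) with hr₁'
  set h₁ : ℝ → ℝ := fun b => -√2 * g₀ b with hh₁
  set g₂ : ℝ → ℝ := fun a => -√2 * (1 - a ^ 2) * (3 * g₁ a + a * g₁' a) with hg₂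
  set r₂ : ℝ → ℝ → ℝ := fun a b =>
    √2 * a * b * h₁ b - √2 * (1 - a ^ 2) * (2 * r₁ a b + a * r₁' a b) with hr₂
  set h₂ : ℝ → ℝ := fun b => -√2 * h₁ b with hh₂
  have hsq : √2 ^ 2 = 2 := sq_sqrt (by norm_num)
  have dg₀ : ∀ a, HasDerivAt g₀ (g₀' a) a := fun a => by
    refine ((((hasDerivAt_id a).pow 2).const_mul 6).const_sub 6).congr_deriv ?_
    simp [hg₀']; ring
  have dr₀ : ∀ a b, HasDerivAt (fun a => r₀ a b) (r₀' a b) a := fun a b => by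
    refine ((((((hasDerivAt_id a).pow 2).const_mul 15).const_add (-12)).add_const
      (15 * b ^ 2)).sub (((hasDerivAt_id a).const_mul 18).mul_const b)).congr_deriv ?_
    simp [hr₀']; ring
  have dg₁ : ∀ a, HasDerivAt g₁ (g₁' a) a := fun a => by
    have e : g₁ = fun a => -√2 * (18 - 48 * a ^ 2 + 30 * a ^ 4) := by
      ext a; simp only [hg₁, hg₀, hg₀']; ring
    rw [e]
    refine ((((((hasDerivAt_id a).pow 2).const_mul 48).const_sub 18).add
      (((hasDerivAt_id a).pow 4).const_mul 30)).const_mul (-√2)).congr_deriv ?_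
    simp [hg₁']; ring
  have dr₁ : ∀ a b, HasDerivAt (fun a => r₁ a b) (r₁' a b) a := fun a b => by
    have i := hasDerivAt_id a
    have e : (fun a => r₁ a b) = fun a => √2 * b * g₀ b * a - √2 * ((1 - a ^ 2) *
        (60 * a ^ 2 - 54 * b * a + (-24 + 30 * b ^ 2))) := by
      ext a; simp only [hr₁, hr₀, hr₀']; ring
    rw [e]
    refine ((i.const_mul (√2 * b * g₀ b)).sub ((((i.pow 2).const_sub 1).mul
      ((((i.pow 2).const_mul 60).sub (i.const_mul (54 * b))).add_const
        (-24 + 30 * b ^ 2))).const_mul √2)).congr_deriv ?_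
    simp [hr₁']; ring
  have cg₀ : Continuous g₀ := by fun_prop
  have cg₀' : Continuous g₀' := by fun_prop
  have cg₁ : Continuous g₁ := by fun_prop
  have cg₁' : Continuous g₁' := by fun_prop
  have ch₁ : Continuous h₁ := by fun_prop
  have ch₂ : Continuous h₂ := by fun_prop
  have cg₂ : Continuous g₂ := by fun_prop
  have cr₀ : Continuous fun p : ℝ × ℝ => r₀ p.1 p.2 := by fun_prop
  have cr₀' : Continuous fun p : ℝ × ℝ => r₀' p.1 p.2 := by fun_prop
  have cr₁ : Continuous fun p : ℝ × ℝ => r₁ p.1 p.2 := by fun_prop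
  have cr₁' : Continuous fun p : ℝ × ℝ => r₁' p.1 p.2 := by fun_prop
  have cr₂ : Continuous fun p : ℝ × ℝ => r₂ p.1 p.2 := by fun_prop
  have hA : ∀ z > 0, HasDerivAt Afun (interact (kinkSplit g₁ h₁ r₁) z) z := fun z hz => by
    refine ((hasDerivAt_interact_kinkSplit cg₀ cg₀' cg₀ cr₀ cr₀' dg₀ dr₀ hz).const_add
      (2 * Epot H01)).congr_of_eventuallyEq ?_
    filter_upwards [Ioi_mem_nhds hz] with w hw using Afun_eq hw
  have hA' : ∀ z > 0, HasDerivAt (deriv Afun) (interact (kinkSplit g₂ h₂ r₂) z) z :=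
    fun z hz => by
    refine (hasDerivAt_interact_kinkSplit cg₁ cg₁' ch₁ cr₁ cr₁' dg₁ dr₁ hz).congr_of_eventuallyEq ?_
    filter_upwards [Ioi_mem_nhds hz] with w hw using (hA w hw).deriv
  have L₀ : leadCoeff g₀ = √2 := leadCoeff_kink
  have L₁ : leadCoeff g₁ = -√2 * leadCoeff g₀ := leadCoeff_deriv cg₀ cg₀' dg₀
  have L₂ : leadCoeff g₂ = -√2 * leadCoeff g₁ := leadCoeff_deriv cg₁ cg₁' dg₁
  have K₁ : leadCoeff h₁ = -√2 * leadCoeff g₀ := leadCoeff_const_mul _ _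
  have K₂ : leadCoeff h₂ = -√2 * leadCoeff h₁ := leadCoeff_const_mul _ _
  have S₀ : leadCoeff g₀ + leadCoeff g₀ = 2 * √2 := by rw [L₀]; ring
  have S₁ : leadCoeff g₁ + leadCoeff h₁ = -4 := by rw [L₁, K₁, L₀]; linarith
  have S₂ : leadCoeff g₂ + leadCoeff h₂ = 4 * √2 := by
    rw [L₂, K₂, L₁, K₁, L₀]; linear_combination 2 * √2 * hsq
  constructor
  · rw [show (2 : WithTop ℕ∞) = 1 + 1 by norm_num, contDiffOn_succ_iff_deriv_of_isOpen isOpen_Ioi]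
    refine ⟨fun z hz => (hA z hz).differentiableAt.differentiableWithinAt, by simp, ?_⟩
    rw [show (1 : WithTop ℕ∞) = 0 + 1 by norm_num, contDiffOn_succ_iff_deriv_of_isOpen isOpen_Ioi]
    refine ⟨fun z hz => (hA' z hz).differentiableAt.differentiableWithinAt, by simp, ?_⟩
    rw [contDiffOn_zero]
    exact (continuousOn_interact (continuous_kinkSplit cg₂ ch₂ cr₂)).congr
      fun z hz => (hA' z hz).deriv
  · obtain ⟨C₀, hC₀, b₀⟩ := interact_kinkSplit_asymptotic cg₀ cg₀ cr₀
    obtain ⟨C₁, hC₁, b₁⟩ := interact_kinkSplit_asymptotic cg₁ ch₁ cr₁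
    obtain ⟨C₂, hC₂, b₂⟩ := interact_kinkSplit_asymptotic cg₂ ch₂ cr₂
    refine ⟨C₀ + C₁ + C₂, by positivity, fun z hz => ?_⟩
    have hz0 : 0 < z := by linarith
    rw [(hA' z hz0).deriv, (hA z hz0).deriv, Afun_eq hz0, add_sub_cancel_left]
    have mono : ∀ C ≤ C₀ + C₁ + C₂, C * z * exp (-(2 * √2) * z) ≤
        (C₀ + C₁ + C₂) * z * exp (-(2 * √2) * z) := fun C h => by gcongr
    refine ⟨?_, ?_, ?_⟩
    · rw [← S₂]
      exact (b₂ z hz).trans (mono C₂ (by linarith))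
    · rw [← sub_neg_eq_add, ← neg_mul, ← S₁]
      exact (b₁ z hz).trans (mono C₁ (by linarith))
    · have hb := b₀ z hz
      rw [S₀] at hb
      exact hb.trans (mono C₀ (by linarith))
end
end

section
/- There exists a constant C > 0 such that for all real x₁, x₂ with z = x₂ − x₁ > 0, the function r : ℝ → ℝ defined by r(x) = [ U̇(H_{-1,0}(x−x₁) + H_{0,1}(x−x₂)) − U̇(H_{-1,0}(x−x₁)) − U̇(H_{0,1}(x−x₂)) ] − 24·e^{−√2 z}·( H_{-1,0}(x−x₁)/(1+e^{−2√2(x−x₁)})^{1/2} + H_{0,1}(x−x₂)/(1+e^{2√2(x−x₂)})^{1/2} ) + 30·e^{−√2 z}·( H_{-1,0}(x−x₁)³/(1+e^{−2√2(x−x₁)})^{1/2} + H_{0,1}(x−x₂)³/(1+e^{2√2(x−x₂)})^{1/2} ) satisfies ‖r‖_{L²(ℝ)} ≤ C·e^{−2√2 z}. -/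
noncomputable section

open MeasureTheory Real

/-- Pointwise bound on the interaction error, in terms of the exponentials `p`, `q` and the factors
`s = (1 + p²)^{-1/2}`, `t = (1 + q²)^{-1/2}`, for which the kinks are `-p s` and `q t`. -/
lemma abs_interaction_error_le {p q s t : ℝ} (hp : 0 < p) (hq : 0 < q) (hs : 0 < s) (ht : 0 < t)
    (hps : s ^ 2 * (1 + p ^ 2) = 1) (hqt : t ^ 2 * (1 + q ^ 2) = 1) :
    |(Udot (-(p * s) + q * t) - Udot (-(p * s)) - Udot (q * t))
        - 24 * (p * q) * (-(p * s) * s + q * t * t)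
        + 30 * (p * q) * ((-(p * s)) ^ 3 * s + (q * t) ^ 3 * t)| ≤
      114 * (p * q) ^ 2 * (p * s ^ 2 + q * t ^ 2) := by
  have hs1 : s ≤ 1 := by nlinarith [mul_pos (pow_pos hs 2) (pow_pos hp 2)]
  have ht1 : t ≤ 1 := by nlinarith [mul_pos (pow_pos ht 2) (pow_pos hq 2)]
  have hs2 : s ^ 2 ≤ 1 := pow_le_one₀ hs.le hs1
  have ht2 : t ^ 2 ≤ 1 := pow_le_one₀ ht.le ht1
  have h1s : 1 - s ≤ p ^ 2 * s ^ 2 := by nlinarith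
  have h1t : 1 - t ≤ q ^ 2 * t ^ 2 := by nlinarith
  have hps1 : (p * s) ^ 2 ≤ 1 := by nlinarith
  have hqt1 : (q * t) ^ 2 ≤ 1 := by nlinarith
  have hX0 : 0 ≤ p * s ^ 2 * (1 - t) := mul_nonneg (by positivity) (by linarith)
  have hY0 : 0 ≤ q * t ^ 2 * (1 - s) := mul_nonneg (by positivity) (by linarith)
  have hX : p * s ^ 2 * (1 - t) ≤ p * q * (q * t ^ 2) := calc
    p * s ^ 2 * (1 - t) ≤ p * 1 * (q ^ 2 * t ^ 2) := by gcongr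
    _ = p * q * (q * t ^ 2) := by ring
  have hY : q * t ^ 2 * (1 - s) ≤ p * q * (p * s ^ 2) := calc
    q * t ^ 2 * (1 - s) ≤ q * 1 * (p ^ 2 * s ^ 2) := by gcongr
    _ = p * q * (p * s ^ 2) := by ring
  have hX3 : (p * s) ^ 2 * (p * s ^ 2 * (1 - t)) ≤ p * q * (q * t ^ 2) :=
    (mul_le_of_le_one_left hX0 hps1).trans hX
  have hY3 : (q * t) ^ 2 * (q * t ^ 2 * (1 - s)) ≤ p * q * (p * s ^ 2) :=
    (mul_le_of_le_one_left hY0 hqt1).trans hY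
  have hX30 := mul_nonneg (sq_nonneg (p * s)) hX0
  have hY30 := mul_nonneg (sq_nonneg (q * t)) hY0
  have hV : s ^ 2 * t ^ 2 * (p * s) ≤ p * s ^ 2 := calc
    s ^ 2 * t ^ 2 * (p * s) ≤ s ^ 2 * 1 * (p * 1) := by gcongr
    _ = p * s ^ 2 := by ring
  have hW : s ^ 2 * t ^ 2 * (q * t) ≤ q * t ^ 2 := calc
    s ^ 2 * t ^ 2 * (q * t) ≤ 1 * t ^ 2 * (q * 1) := by gcongr
    _ = q * t ^ 2 := by ring
  have hV0 : 0 ≤ s ^ 2 * t ^ 2 * (p * s) := by positivity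
  have hW0 : 0 ≤ s ^ 2 * t ^ 2 * (q * t) := by positivity
  have hpq : 0 < p * q := by positivity
  have key : (Udot (-(p * s) + q * t) - Udot (-(p * s)) - Udot (q * t))
        - 24 * (p * q) * (-(p * s) * s + q * t * t)
        + 30 * (p * q) * ((-(p * s)) ^ 3 * s + (q * t) ^ 3 * t) =
      (p * q) * (24 * (p * s ^ 2 * (1 - t)) - 24 * (q * t ^ 2 * (1 - s))
        - 30 * ((p * s) ^ 2 * (p * s ^ 2 * (1 - t)))
        + 30 * ((q * t) ^ 2 * (q * t ^ 2 * (1 - s)))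
        + (p * q) * (60 * (s ^ 2 * t ^ 2 * (q * t)) - 60 * (s ^ 2 * t ^ 2 * (p * s)))) := by
    unfold Udot; ring
  have hV' := mul_le_mul_of_nonneg_left hV hpq.le
  have hW' := mul_le_mul_of_nonneg_left hW hpq.le
  have hV0' := mul_nonneg hpq.le hV0
  have hW0' := mul_nonneg hpq.le hW0
  have hA : 0 ≤ p * q * (p * s ^ 2) := by positivity
  have hB : 0 ≤ p * q * (q * t ^ 2) := by positivity
  rw [key, abs_mul, abs_of_pos hpq, show 114 * (p * q) ^ 2 * (p * s ^ 2 + q * t ^ 2) =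
    (p * q) * (114 * (p * q * (p * s ^ 2)) + 114 * (p * q * (q * t ^ 2))) by ring]
  refine mul_le_mul_of_nonneg_left (abs_le.2 ⟨?_, ?_⟩) hpq.le <;> linarith

/-- `e^y / (1 + e^{2y})`, that is `1 / (2 cosh y)`, is square integrable with an explicit bound. -/
lemma sq_exp_div_one_add_exp_sq_le (y : ℝ) :
    (exp y / (1 + exp y ^ 2)) ^ 2 ≤ (1 + y ^ 2)⁻¹ := by
  have hy := exp_pos y
  have h1 : exp y * (1 + |y|) ≤ 1 + exp y ^ 2 := by
    rcases le_total 0 y with h | h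
    · rw [abs_of_nonneg h]
      nlinarith [add_one_le_exp y]
    · rw [abs_of_nonpos h]
      have h2 : exp y * exp (-y) = 1 := by rw [← exp_add]; simp
      nlinarith [add_one_le_exp (-y)]
  have h2 : exp y / (1 + exp y ^ 2) ≤ (1 + |y|)⁻¹ := by
    rw [inv_eq_one_div, div_le_div_iff₀ (by positivity) (by positivity)]
    linarith
  calc (exp y / (1 + exp y ^ 2)) ^ 2 ≤ ((1 + |y|)⁻¹) ^ 2 := by gcongr
    _ = ((1 + |y|) ^ 2)⁻¹ := by rw [inv_pow]
    _ ≤ (1 + y ^ 2)⁻¹ := by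
      gcongr
      nlinarith [sq_abs y, abs_nonneg y]

lemma sq_exp_sqrt_two_mul_div_le (y : ℝ) :
    (exp (√2 * y) / (1 + exp (√2 * y) ^ 2)) ^ 2 ≤ (1 + y ^ 2)⁻¹ := by
  refine (sq_exp_div_one_add_exp_sq_le _).trans (inv_anti₀ (by positivity) ?_)
  rw [mul_pow, sq_sqrt zero_le_two]
  nlinarith [sq_nonneg y]

/-- Precise expansion of the nonlinear interaction term, with `L²` error `O(e^{-2√2 z})`. -/
theorem interaction_expansion :
    ∃ C > (0:ℝ), ∀ x1 x2 : ℝ, 0 < x2 - x1 →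
      L2norm (fun x =>
          (Udot (Hm10 (x - x1) + H01 (x - x2)) - Udot (Hm10 (x - x1)) - Udot (H01 (x - x2)))
          - 24 * Real.exp (-(Real.sqrt 2) * (x2 - x1)) *
              (Hm10 (x - x1) / Real.sqrt (1 + Real.exp (-(2 * Real.sqrt 2) * (x - x1)))
                + H01 (x - x2) / Real.sqrt (1 + Real.exp (2 * Real.sqrt 2 * (x - x2))))
          + 30 * Real.exp (-(Real.sqrt 2) * (x2 - x1)) *
              (Hm10 (x - x1) ^ 3 / Real.sqrt (1 + Real.exp (-(2 * Real.sqrt 2) * (x - x1)))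
                + H01 (x - x2) ^ 3 / Real.sqrt (1 + Real.exp (2 * Real.sqrt 2 * (x - x2))))) ≤
        C * Real.exp (-(2 * Real.sqrt 2) * (x2 - x1)) := by
  refine ⟨228 * √π, by positivity, fun x1 x2 _ => ?_⟩
  set ε := exp (-√2 * (x2 - x1)) with hε
  have hε2 : exp (-(2 * √2) * (x2 - x1)) = ε ^ 2 := by
    rw [hε, ← exp_nat_mul]; congr 1; push_cast; ring
  rw [hε2]
  have hint1 : Integrable fun x : ℝ => (1 + (x1 - x) ^ 2)⁻¹ :=
    integrable_inv_one_add_sq.comp_sub_left x1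
  have hint2 : Integrable fun x : ℝ => (1 + (x - x2) ^ 2)⁻¹ :=
    integrable_inv_one_add_sq.comp_sub_right x2
  have hI1 : ∫ x : ℝ, (1 + (x1 - x) ^ 2)⁻¹ = π :=
    (integral_sub_left_eq_self (fun x : ℝ => (1 + x ^ 2)⁻¹) volume x1).trans
      integral_univ_inv_one_add_sq
  have hI2 : ∫ x : ℝ, (1 + (x - x2) ^ 2)⁻¹ = π :=
    (integral_sub_right_eq_self (fun x : ℝ => (1 + x ^ 2)⁻¹) x2).trans
      integral_univ_inv_one_add_sq
  have hI : ∫ x : ℝ, 2 * (114 * ε ^ 2) ^ 2 * ((1 + (x1 - x) ^ 2)⁻¹ + (1 + (x - x2) ^ 2)⁻¹) =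
      (228 * ε ^ 2) ^ 2 * π := by
    rw [integral_const_mul, integral_add hint1 hint2, hI1, hI2]; ring
  have hfinal : √((228 * ε ^ 2) ^ 2 * π) = 228 * √π * ε ^ 2 := by
    rw [sqrt_mul (by positivity), sqrt_sq (by positivity)]; ring
  rw [L2norm, ← hfinal, ← hI]
  refine sqrt_le_sqrt (integral_mono_of_nonneg (.of_forall fun x => sq_nonneg _)
    ((hint1.add hint2).const_mul _) (.of_forall fun x => ?_))
  have hp := exp_pos (√2 * (x1 - x))
  have hq := exp_pos (√2 * (x - x2))
  have hp1 := sq_exp_sqrt_two_mul_div_le (x1 - x)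
  have hq1 := sq_exp_sqrt_two_mul_div_le (x - x2)
  have hpq : ε = exp (√2 * (x1 - x)) * exp (√2 * (x - x2)) := by
    rw [hε, ← exp_add]; congr 1; ring
  have hp2 : exp (-(2 * √2) * (x - x1)) = exp (√2 * (x1 - x)) ^ 2 := by
    rw [← exp_nat_mul]; congr 1; push_cast; ring
  have hp3 : exp (2 * √2 * (x1 - x)) = exp (√2 * (x1 - x)) ^ 2 := by
    rw [← exp_nat_mul]; congr 1; push_cast; ring
  have hq2 : exp (2 * √2 * (x - x2)) = exp (√2 * (x - x2)) ^ 2 := by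
    rw [← exp_nat_mul]; congr 1; push_cast; ring
  simp only [Hm10, H01, neg_sub, hp2, hp3, hq2]
  rw [hpq]
  generalize exp (√2 * (x1 - x)) = p at *
  generalize exp (√2 * (x - x2)) = q at *
  have hs2 : (√(1 + p ^ 2))⁻¹ ^ 2 = (1 + p ^ 2)⁻¹ := by rw [inv_pow, sq_sqrt (by positivity)]
  have ht2 : (√(1 + q ^ 2))⁻¹ ^ 2 = (1 + q ^ 2)⁻¹ := by rw [inv_pow, sq_sqrt (by positivity)]
  have h := abs_interaction_error_le (s := (√(1 + p ^ 2))⁻¹) (t := (√(1 + q ^ 2))⁻¹) hp hq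
    (by positivity) (by positivity) (by rw [hs2, inv_mul_cancel₀ (by positivity)])
    (by rw [ht2, inv_mul_cancel₀ (by positivity)])
  rw [hs2, ht2] at h
  simp only [← div_eq_mul_inv] at h
  have hsq := sq_le_sq' (neg_le_of_abs_le h) (le_of_abs_le h)
  refine hsq.trans ?_
  rw [mul_pow, show 2 * (114 * (p * q) ^ 2) ^ 2 * ((1 + (x1 - x) ^ 2)⁻¹ + (1 + (x - x2) ^ 2)⁻¹) =
    (114 * (p * q) ^ 2) ^ 2 * (2 * ((1 + (x1 - x) ^ 2)⁻¹ + (1 + (x - x2) ^ 2)⁻¹)) by ring]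
  exact mul_le_mul_of_nonneg_left (add_sq_le.trans (by linarith)) (by positivity)
end
end
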